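/- Let n ≥ 1 and let d̃ : ℝⁿ × ℝⁿ × ℝ × (0,∞) → ℝ be defined by d̃(x, y, t, ρ) = (ρ⁴ + (|x|² + |y|²)² + 16t²)^{1/4}. At every point of ℝⁿ × ℝⁿ × ℝ × (0,∞) other than where all of x, y, t vanish (and at all points with ρ > 0, where d̃ is smooth), the horizontal gradient satisfies |∇ d̃|² := Σ_{j=1}^n (∂_{x_j} d̃ + (y_j/2) ∂_t d̃)² + Σ_{j=1}^n (∂_{y_j} d̃ − (x_j/2) ∂_t d̃)² + (∂_ρ d̃)² ≤ 1. -/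

import Mathlib

/-- The gauge distance d̃(x,y,t,ρ) = (ρ⁴ + (|x|²+|y|²)² + 16t²)^{1/4} on ℍⁿ × ℝ⁺. -/
noncomputable def dtil (n : ℕ) (w : (Fin n → ℝ) × (Fin n → ℝ) × ℝ × ℝ) : ℝ :=
  (w.2.2.2 ^ 4 + (∑ j, (w.1 j) ^ 2 + ∑ j, (w.2.1 j) ^ 2) ^ 2 + 16 * w.2.2.1 ^ 2) ^ ((1 : ℝ) / 4)

/-- The differential of the gauge at a point with `0 < ρ`, applied to a vector. -/
theorem fderiv_dtil_apply (n : ℕ) (w v : (Fin n → ℝ) × (Fin n → ℝ) × ℝ × ℝ)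
    (hρ : 0 < w.2.2.2) :
    fderiv ℝ (dtil n) w v =
      (w.2.2.2 ^ 4 + (∑ j, (w.1 j) ^ 2 + ∑ j, (w.2.1 j) ^ 2) ^ 2 + 16 * w.2.2.1 ^ 2) ^
          ((1 : ℝ) / 4 - 1) *
        (w.2.2.2 ^ 3 * v.2.2.2 +
          (∑ j, (w.1 j) ^ 2 + ∑ j, (w.2.1 j) ^ 2) *
            (∑ j, w.1 j * v.1 j + ∑ j, w.2.1 j * v.2.1 j) +
          8 * w.2.2.1 * v.2.2.1) := by
  have hx (j : Fin n) : HasFDerivAt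
      (fun w : (Fin n → ℝ) × (Fin n → ℝ) × ℝ × ℝ => w.1 j) _ w :=
    ((ContinuousLinearMap.proj (R := ℝ) (φ := fun _ : Fin n => ℝ) j).comp
      (ContinuousLinearMap.fst ℝ (Fin n → ℝ) ((Fin n → ℝ) × ℝ × ℝ))).hasFDerivAt
  have hy (j : Fin n) : HasFDerivAt
      (fun w : (Fin n → ℝ) × (Fin n → ℝ) × ℝ × ℝ => w.2.1 j) _ w :=
    ((ContinuousLinearMap.proj (R := ℝ) (φ := fun _ : Fin n => ℝ) j).comp
      ((ContinuousLinearMap.fst ℝ (Fin n → ℝ) (ℝ × ℝ)).comp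
        (ContinuousLinearMap.snd ℝ (Fin n → ℝ) ((Fin n → ℝ) × ℝ × ℝ)))).hasFDerivAt
  have htρ := (ContinuousLinearMap.snd ℝ (Fin n → ℝ) (ℝ × ℝ)).comp
    (ContinuousLinearMap.snd ℝ (Fin n → ℝ) ((Fin n → ℝ) × ℝ × ℝ)) |>.hasFDerivAt (x := w)
  have ht : HasFDerivAt (fun w : (Fin n → ℝ) × (Fin n → ℝ) × ℝ × ℝ => w.2.2.1) _ w := htρ.fst
  have hr : HasFDerivAt (fun w : (Fin n → ℝ) × (Fin n → ℝ) × ℝ × ℝ => w.2.2.2) _ w := htρ.snd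
  have hs := (HasFDerivAt.fun_sum (u := Finset.univ) fun j _ => (hx j).pow 2).fun_add
    (HasFDerivAt.fun_sum (u := Finset.univ) fun j _ => (hy j).pow 2)
  have hN := (((hr.pow 4).fun_add (hs.pow 2)).fun_add ((ht.pow 2).const_mul 16)).rpow_const
    (p := (1 : ℝ) / 4) (Or.inl (by positivity))
  have hd : HasFDerivAt (dtil n) _ w := hN
  rw [hd.fderiv]
  simp only [add_apply, smul_apply,
    sum_apply, ContinuousLinearMap.comp_apply, ContinuousLinearMap.proj_apply,
    ContinuousLinearMap.coe_fst', ContinuousLinearMap.coe_snd', smul_eq_mul, nsmul_eq_mul]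
  norm_num [mul_assoc, ← Finset.mul_sum]
  ring

theorem horizontal_gradient_gauge_le_one (n : ℕ) (hn : 1 ≤ n)
    (w : (Fin n → ℝ) × (Fin n → ℝ) × ℝ × ℝ) (hρ : 0 < w.2.2.2) :
    (∑ j, (fderiv ℝ (dtil n) w ((Pi.single j 1 : Fin n → ℝ), 0, 0, 0)
            + w.2.1 j / 2 * fderiv ℝ (dtil n) w (0, 0, 1, 0)) ^ 2)
      + (∑ j, (fderiv ℝ (dtil n) w (0, (Pi.single j 1 : Fin n → ℝ), 0, 0)
            - w.1 j / 2 * fderiv ℝ (dtil n) w (0, 0, 1, 0)) ^ 2)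
      + (fderiv ℝ (dtil n) w (0, 0, 0, 1)) ^ 2 ≤ 1 := by
  obtain ⟨x, y, t, ρ⟩ := w
  simp only [fderiv_dtil_apply n _ _ hρ]
  dsimp only at hρ ⊢
  set s := ∑ j, x j ^ 2 + ∑ j, y j ^ 2 with hs
  set N := ρ ^ 4 + s ^ 2 + 16 * t ^ 2 with hN
  have hs0 : 0 ≤ s := by positivity
  have hN0 : 0 < N := by positivity
  set c := N ^ ((1 : ℝ) / 4 - 1) with hc
  have hcN : c ^ 2 * √N ^ 3 = 1 := by
    rw [hc, Real.sqrt_eq_rpow, ← Real.rpow_mul_natCast hN0.le, ← Real.rpow_mul_natCast hN0.le,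
      ← Real.rpow_add hN0]
    norm_num
  have hsum (a b : ℝ) (u v : Fin n → ℝ) :
      ∑ j, (a * u j + b * v j) ^ 2 =
        a ^ 2 * ∑ j, u j ^ 2 + 2 * a * b * ∑ j, u j * v j + b ^ 2 * ∑ j, v j ^ 2 := by
    simp only [Finset.mul_sum, ← Finset.sum_add_distrib]
    exact Finset.sum_congr rfl fun j _ => by ring
  have hX : ∑ j, (c * (s * x j) + y j / 2 * (c * (8 * t))) ^ 2 =
      ∑ j, (c * s * x j + 4 * c * t * y j) ^ 2 :=
    Finset.sum_congr rfl fun j _ => by ring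
  have hY : ∑ j, (c * (s * y j) - x j / 2 * (c * (8 * t))) ^ 2 =
      ∑ j, (c * s * y j + -(4 * c * t) * x j) ^ 2 :=
    Finset.sum_congr rfl fun j _ => by ring
  have hxy : ∑ j, y j * x j = ∑ j, x j * y j := Finset.sum_congr rfl fun j _ => mul_comm _ _
  simp [Pi.single_apply]
  rw [hX, hY, hsum, hsum, hxy]
  have hsN : s ≤ √N := Real.le_sqrt_of_sq_le (by rw [hN]; nlinarith [sq_nonneg t, sq_nonneg (ρ ^ 2)])
  have hρN : ρ ^ 2 ≤ √N :=
    Real.le_sqrt_of_sq_le (by rw [hN]; nlinarith [sq_nonneg t, sq_nonneg s])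
  have hM : √N ^ 2 = N := Real.sq_sqrt hN0.le
  have key : s * (s ^ 2 + 16 * t ^ 2) + ρ ^ 2 * ρ ^ 4 ≤ √N ^ 3 := by
    calc s * (s ^ 2 + 16 * t ^ 2) + ρ ^ 2 * ρ ^ 4
        ≤ √N * (s ^ 2 + 16 * t ^ 2) + √N * ρ ^ 4 := by gcongr
      _ = √N * N := by rw [hN]; ring
      _ = √N ^ 3 := by rw [pow_succ', hM]
  calc _ = c ^ 2 * (s * (s ^ 2 + 16 * t ^ 2) + ρ ^ 2 * ρ ^ 4) := by
        linear_combination (-c ^ 2 * (s ^ 2 + 16 * t ^ 2)) * hs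
    _ ≤ c ^ 2 * √N ^ 3 := by gcongr
    _ = 1 := hcN
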